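/- arXiv:2406.07326 — 2 statements merged into one kernel-verified Lean document; each statement's English description precedes it below -/
import Mathlib

section
/- Let q be a prime power, F a finite field with q^2 elements, 1 ≤ d ≤ q, and G ∈ F[x_0,x_1,x_2,x_3] a nonzero homogeneous polynomial of degree d. If Π is a plane of ℙ^3(F) such that the vertex P_0 = [0:0:0:1] does not lie on Π and Π ⊆ V(G)(F), then |V(G)(F) ∩ V_2' ∩ (ℙ^3(F) \ Π)| ≤ (d−1)(q+1)q^2. -/
open MvPolynomial

noncomputable section

/-- The projective space ℙ³(F): 1-dimensional F-linear subspaces of F⁴. -/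
abbrev P3 (F : Type) [Field F] := Projectivization F (Fin 4 → F)

/-- The degenerate Hermitian surface of rank 3:
    V₂' = {[x] ∈ ℙ³(F) : x₀^{q+1} + x₁^{q+1} + x₂^{q+1} = 0}. -/
def hermV2' (q : ℕ) (F : Type) [Field F] : Set (P3 F) :=
  {x | x.rep 0 ^ (q + 1) + x.rep 1 ^ (q + 1) + x.rep 2 ^ (q + 1) = 0}

/-- V(G)(F) = {[x] ∈ ℙ³(F) : G(x) = 0}, well defined for G homogeneous. -/
def VG3 {F : Type} [Field F] (G : MvPolynomial (Fin 4) F) : Set (P3 F) :=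
  {x | eval x.rep G = 0}

/-- A plane of ℙ³(F): points contained in a 3-dimensional F-linear subspace of F⁴. -/
def IsPlane3 (F : Type) [Field F] (S : Set (P3 F)) : Prop :=
  ∃ W : Submodule F (Fin 4 → F), Module.finrank F W = 3 ∧
    S = {x : P3 F | x.submodule ≤ W}

/-- The vertex P₀ = [0:0:0:1] of the cone V₂'. -/
def vertexP0 (F : Type) [Field F] : P3 F :=
  Projectivization.mk F ![0, 0, 0, 1] (by
    intro h
    have h3 := congrFun h 3
    simp at h3)

lemma homogeneousComponent_mul_of_left {σ R : Type*} [CommRing R] {h : MvPolynomial σ R} {n : ℕ}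
    (hh : h.IsHomogeneous n) (c : MvPolynomial σ R) (N : ℕ) :
    homogeneousComponent (n + N) (h * c) = h * homogeneousComponent N c := by
  let : GradedAlgebra (homogeneousSubmodule σ R) := gradedAlgebra
  have := DirectSum.coe_decompose_mul_add_of_left_mem (homogeneousSubmodule σ R) (j := N) (b := c)
    ((mem_homogeneousSubmodule n h).2 hh)
  exact (decomposition.decompose'_apply (h * c) (n + N)).symm.trans
    (this.trans (congrArg (h * ·) (decomposition.decompose'_apply c N)))

/-- The linear form attached to a functional on `F^n`. -/
def linearForm {F : Type} [Field F] {n : ℕ} (φ : Module.Dual F (Fin n → F)) :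
    MvPolynomial (Fin n) F := ∑ i, C (φ (Pi.single i 1)) * X i

lemma isHomogeneous_linearForm {F : Type} [Field F] {n : ℕ} (φ : Module.Dual F (Fin n → F)) :
    (linearForm φ).IsHomogeneous 1 :=
  IsHomogeneous.sum _ _ _ fun i _ => isHomogeneous_C_mul_X _ i

lemma eval_linearForm {F : Type} [Field F] {n : ℕ} (φ : Module.Dual F (Fin n → F))
    (v : Fin n → F) : eval v (linearForm φ) = φ v := by
  conv_rhs => rw [pi_eq_sum_univ' v]
  simp [linearForm, mul_comm, Pi.single]

lemma two_mul_finrank_homogeneousSubmodule (F : Type) [Field F] (t : ℕ) :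
    2 * Module.finrank F (homogeneousSubmodule (Fin 3) F t) = (t + 1) * (t + 2) := by
  have h : homogeneousSubmodule (Fin 3) F t =
      restrictSupport F ((Finset.univ : Finset (Fin 3)).finsuppAntidiag t : Set (Fin 3 →₀ ℕ)) := by
    rw [homogeneousSubmodule_eq_finsupp_supported]
    congr 1
    ext d
    simp [Finsupp.degree_eq_sum, Finset.mem_finsuppAntidiag]
  rw [h, Module.finrank_eq_card_basis (basisRestrictSupport F _)]
  have : Fintype.card ((Finset.univ : Finset (Fin 3)).finsuppAntidiag t : Set (Fin 3 →₀ ℕ))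
      = (t + 2).choose 2 := by
    simp [Finset.card_finsuppAntidiag_nat_eq_choose]
    rw [add_comm, Nat.choose_symm_add]
  rw [this, Nat.choose_two_right, Nat.mul_div_cancel' (Nat.even_mul_pred_self _).two_dvd]
  simp; ring

lemma exists_homogeneous_separating {F : Type} [Field F] {n : ℕ}
    (T : Finset (Projectivization F (Fin n → F))) (P : Projectivization F (Fin n → F)) (s : ℕ) :
    ∃ p : MvPolynomial (Fin n) F, p.IsHomogeneous (T.card + s) ∧ eval P.rep p ≠ 0 ∧
      ∀ P' ∈ T, P' ≠ P → eval P'.rep p = 0 := by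
  have key : ∀ P' : Projectivization F (Fin n → F), ∃ φ : Module.Dual F (Fin n → F),
      φ P.rep ≠ 0 ∧ (P' ≠ P → φ P'.rep = 0) := by
    intro P'
    by_cases hP : P' = P
    · obtain ⟨φ, hφ⟩ := Module.Projective.exists_dual_ne_zero F P.rep_nonzero
      exact ⟨φ, hφ, fun h => absurd hP h⟩
    · have : P.rep ∉ Submodule.span F {P'.rep} := by
        intro h
        obtain ⟨a, ha⟩ := Submodule.mem_span_singleton.1 h
        apply hP
        rw [← P.mk_rep, ← P'.mk_rep, eq_comm, Projectivization.mk_eq_mk_iff']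
        exact ⟨a, ha⟩
      obtain ⟨φ, hφ, h0⟩ := Submodule.exists_dual_map_eq_bot_of_notMem this inferInstance
      refine ⟨φ, hφ, fun _ => ?_⟩
      have : φ P'.rep ∈ (Submodule.span F {P'.rep}).map φ :=
        Submodule.mem_map_of_mem (Submodule.mem_span_singleton_self _)
      rwa [h0, Submodule.mem_bot] at this
  choose φ hφ h0 using key
  refine ⟨(∏ P' ∈ T, linearForm (φ P')) * linearForm (φ P) ^ s, ?_, ?_, ?_⟩
  · have h1 := IsHomogeneous.prod T (fun P' => linearForm (φ P')) (fun _ => 1)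
      fun P' _ => isHomogeneous_linearForm (φ P')
    have h2 := (isHomogeneous_linearForm (φ P)).pow s
    simpa using h1.mul h2
  · simp [eval_linearForm, Finset.prod_ne_zero_iff, hφ]
  · intro P' hP' hne
    simp only [map_mul, eval_prod, mul_eq_zero]
    left
    exact Finset.prod_eq_zero hP' (by rw [eval_linearForm, h0 _ hne])

/-- Bézout's inequality for the rational points of two plane curves, one of them irreducible. -/
lemma card_common_zeros_le {F : Type} [Field F] {m n : ℕ} {f h : MvPolynomial (Fin 3) F}
    (hf : f.IsHomogeneous m) (hh : h.IsHomogeneous n) (hirr : Irreducible h) (hdvd : ¬ h ∣ f)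
    (T : Finset (Projectivization F (Fin 3 → F)))
    (hT : ∀ P ∈ T, eval P.rep f = 0 ∧ eval P.rep h = 0) : T.card ≤ m * n := by
  classical
  set N := T.card with hN
  let V : ℕ → Submodule F (MvPolynomial (Fin 3) F) := homogeneousSubmodule (Fin 3) F
  have fin (t) : Module.Finite F (V t) :=
    Module.Finite.iff_fg.2 (homogeneousSubmodule_fg (Fin 3) F t)
  have D (t) : 2 * Module.finrank F (V t) = (t + 1) * (t + 2) :=
    two_mul_finrank_homogeneousSubmodule F t
  -- evaluation at the points
  let ev : V (N + (m + n)) →ₗ[F] (T → F) :=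
    { toFun := fun p P => eval P.1.rep p.1
      map_add' := fun a b => by ext; simp
      map_smul' := fun a b => by ext; simp [smul_eval] }
  have ev_surj : Function.Surjective ev := by
    rw [← LinearMap.range_eq_top, eq_top_iff, ← (Pi.basisFun F T).span_eq, Submodule.span_le]
    rintro _ ⟨P, rfl⟩
    obtain ⟨p, hp, hp1, hp0⟩ := exists_homogeneous_separating T P.1 (m + n)
    refine ⟨(eval P.1.rep p)⁻¹ • ⟨p, hp⟩, ?_⟩
    ext P'
    by_cases hPP : P' = P
    · subst hPP
      simp [ev, hp1]
    · have := hp0 P'.1 P'.2 (fun h => hPP (Subtype.ext h))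
      simp [ev, this, hPP]
  let μ : (V (N + n) × V (N + m)) →ₗ[F] V (N + (m + n)) :=
    { toFun := fun p => ⟨p.1.1 * f + p.2.1 * h, by
        have h1 := (show p.1.1.IsHomogeneous (N + n) from p.1.2).mul hf
        have h2 := (show p.2.1.IsHomogeneous (N + m) from p.2.2).mul hh
        rw [show N + n + m = N + (m + n) by ring] at h1
        rw [show N + m + n = N + (m + n) by ring] at h2
        exact h1.add h2⟩
      map_add' := fun a b => by ext1; simp; ring
      map_smul' := fun a b => by ext1; simp [smul_add] }
  let κ : V N →ₗ[F] (V (N + n) × V (N + m)) :=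
    { toFun := fun c => (⟨c.1 * h, (show c.1.IsHomogeneous N from c.2).mul hh⟩,
        ⟨-(c.1 * f), ((show c.1.IsHomogeneous N from c.2).mul hf).neg⟩)
      map_add' := fun a b => by ext1 <;> ext1 <;> simp <;> ring
      map_smul' := fun a b => by ext1 <;> ext1 <;> simp }
  have hh0 : h ≠ 0 := hirr.ne_zero
  have hker : LinearMap.ker μ ≤ LinearMap.range κ := by
    rintro ⟨⟨a, ha⟩, ⟨b, hb⟩⟩ hab
    have hab : a * f + b * h = 0 := congrArg Subtype.val hab
    have hd : h ∣ a * f := ⟨-b, by linear_combination hab⟩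
    obtain ⟨c, rfl⟩ := (hirr.prime.dvd_or_dvd hd).resolve_right hdvd
    have hbc : b = -(c * f) := mul_right_cancel₀ hh0 (by linear_combination hab)
    have hc : c.IsHomogeneous N := by
      have h1 := homogeneousComponent_mul_of_left hh c N
      rw [homogeneousComponent_of_mem ha, if_pos (add_comm n N)] at h1
      rw [mul_left_cancel₀ hh0 h1]
      exact homogeneousComponent_isHomogeneous N c
    refine ⟨⟨c, hc⟩, ?_⟩
    ext1 <;> ext1
    · exact mul_comm c h
    · exact hbc.symm
  have hrange : LinearMap.range μ ≤ LinearMap.ker ev := by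
    rintro _ ⟨p, rfl⟩
    rw [LinearMap.mem_ker]
    ext P
    simp [ev, μ, hT P.1 P.2]
  have e1 := LinearMap.finrank_range_add_finrank_ker μ
  have e2 := LinearMap.finrank_range_add_finrank_ker ev
  have e3 := Submodule.finrank_mono hker
  have e4 := Submodule.finrank_mono hrange
  have e5 := LinearMap.finrank_range_le κ
  rw [Module.finrank_prod] at e1
  rw [LinearMap.range_eq_top.2 ev_surj, finrank_top, Module.finrank_fintype_fun_eq_card,
    Fintype.card_coe] at e2
  have d1 := D N
  have d2 := D (N + n)
  have d3 := D (N + m)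
  have d4 := D (N + (m + n))
  have : 2 * N ≤ 2 * (m * n) := by nlinarith
  omega

/-- The Hermitian form `x₀^(q+1) + x₁^(q+1) + x₂^(q+1)`. -/
def hermitianForm (F : Type) [Field F] (q : ℕ) : MvPolynomial (Fin 3) F :=
  X 0 ^ (q + 1) + X 1 ^ (q + 1) + X 2 ^ (q + 1)

lemma irreducible_hermitianForm {F : Type} [Field F] {q : ℕ} (hq : (q : F) = 0)
    {ζ : F} (hζ : ζ ^ (q + 1) = -1) : Irreducible (hermitianForm F q) := by
  have hζ0 : ζ ≠ 0 := by rintro rfl; simp at hζ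
  rw [← MulEquiv.irreducible_iff (finSuccEquiv F 2)]
  have himg : finSuccEquiv F 2 (hermitianForm F q) =
      Polynomial.X ^ (q + 1) + Polynomial.C (X 0 ^ (q + 1) + X 1 ^ (q + 1)) := by
    have h1 : (1 : Fin 3) = Fin.succ 0 := rfl
    have h2 : (2 : Fin 3) = Fin.succ 1 := rfl
    rw [hermitianForm, h1, h2]
    simp only [map_add, map_pow, finSuccEquiv_X_zero, finSuccEquiv_X_succ]
    ring
  rw [himg]
  let φ : MvPolynomial (Fin 2) F →ₐ[F] Polynomial F :=
    aeval ![Polynomial.C ζ * Polynomial.X, Polynomial.X]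
  have hmon : (Polynomial.X ^ (q + 1) + Polynomial.C (X 0 ^ (q + 1) + X 1 ^ (q + 1)) :
      Polynomial (MvPolynomial (Fin 2) F)).Monic := Polynomial.monic_X_pow_add_C _ q.succ_ne_zero
  have ha : φ (X 0 ^ (q + 1) + X 1 ^ (q + 1)) = 0 := by
    simp only [map_add, map_pow, φ, aeval_X, Matrix.cons_val_zero, Matrix.cons_val_one]
    rw [mul_pow, ← Polynomial.C_pow, hζ]
    simp
  have hd := Polynomial.degree_X_pow_add_C (Nat.succ_pos q)
    (X 0 ^ (q + 1) + X 1 ^ (q + 1) : MvPolynomial (Fin 2) F)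
  refine Polynomial.irreducible_of_eisenstein_criterion (P := RingHom.ker φ)
    (RingHom.ker_isPrime _) ?_ ?_ ?_ ?_ hmon.isPrimitive
  · rw [hmon.leadingCoeff]; simp
  · intro n hn
    rw [hd, Nat.cast_lt] at hn
    rw [Polynomial.coeff_add, Polynomial.coeff_X_pow, if_neg hn.ne, zero_add, Polynomial.coeff_C]
    split_ifs
    · exact ha
    · exact zero_mem _
  · rw [hd]; exact_mod_cast q.succ_pos
  · intro hmem
    rw [Polynomial.coeff_add, Polynomial.coeff_X_pow, if_neg q.succ_ne_zero.symm, zero_add,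
      Polynomial.coeff_C_zero] at hmem
    have hder : ∀ a ∈ RingHom.ker φ ^ 2, φ (pderiv 0 a) = 0 := by
      intro a ha
      rw [pow_two] at ha
      induction ha using Submodule.mul_induction_on' with
      | mem_mul_mem b hb c hc =>
        rw [RingHom.mem_ker] at hb hc
        simp [hb, hc]
      | add b _ c _ hb hc => simp [hb, hc]
    have := hder _ hmem
    have hq' : ((q : ℕ) : MvPolynomial (Fin 2) F) = 0 := by
      rw [← map_natCast (C : F →+* _), hq, map_zero]
    simp [hq', φ, hζ0] at this

lemma exists_pow_eq_neg_one {F : Type} [Field F] [Fintype F] {q : ℕ} (hq : IsPrimePow q)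
    (hF : Fintype.card F = q ^ 2) :
    (q : F) = 0 ∧ ∃ ζ ξ : F, ζ ^ (q + 1) = -1 ∧ ξ ^ (q + 1) = -1 ∧ ζ ≠ ξ := by
  have hq0 : (q : F) = 0 := by
    have := FiniteField.cast_card_eq_zero F
    rw [hF] at this
    simpa using this
  have hq2 := hq.two_le
  refine ⟨hq0, ?_⟩
  have hneg : (-1 : F) ^ q = -1 := by
    obtain ⟨p, k, hp, hk, rfl⟩ := hq
    have hp := hp.nat_prime
    have := Fact.mk hp
    have : CharP F p := by
      have : (p : F) = 0 := by simpa [hk.ne'] using hq0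
      exact (CharP.charP_iff_prime_eq_zero hp).2 this
    exact neg_one_pow_char_pow ..
  have hneg' : (-1 : Fˣ) ^ (q - 1) = 1 := by
    have : (-1 : Fˣ) ^ q = -1 := by ext; simpa using hneg
    have h2 : (-1 : Fˣ) ^ (q - 1) * (-1) = 1 * (-1) := by
      rw [← pow_succ, Nat.sub_add_cancel (by omega), this, one_mul]
    exact mul_right_cancel h2
  obtain ⟨γ, hγ⟩ := IsCyclic.exists_generator (α := Fˣ)
  have hord : orderOf γ = (q - 1) * (q + 1) := by
    classical
    rw [orderOf_eq_card_of_forall_mem_zpowers hγ, Nat.card_units, Nat.card_eq_fintype_card, hF]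
    obtain ⟨r, rfl⟩ := Nat.exists_eq_add_of_le' (show 1 ≤ q by omega)
    simp; ring_nf; omega
  obtain ⟨j, hj⟩ := (mem_powers_iff_mem_zpowers.2 (hγ (-1)))
  simp only at hj
  have hdvd : (q + 1) ∣ j := by
    have : γ ^ (j * (q - 1)) = 1 := by rw [pow_mul, hj, hneg']
    have := orderOf_dvd_of_pow_eq_one this
    rw [hord, mul_comm j] at this
    exact Nat.dvd_of_mul_dvd_mul_left (by omega) this
  obtain ⟨i, rfl⟩ := hdvd
  have h1 : (γ ^ i) ^ (q + 1) = -1 := by rw [← pow_mul, mul_comm, hj]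
  have h2 : (γ ^ (q - 1)) ^ (q + 1) = 1 := by rw [← pow_mul, ← hord, pow_orderOf_eq_one]
  refine ⟨(γ ^ i : Fˣ), (γ ^ i * γ ^ (q - 1) : Fˣ), ?_, ?_, ?_⟩
  · simpa using congrArg Units.val h1
  · simpa [mul_pow] using congrArg Units.val (show (γ ^ i * γ ^ (q - 1)) ^ (q + 1) = -1 by
      rw [mul_pow, h1, h2, mul_one])
  · intro h
    have h := Units.ext h
    rw [eq_comm, mul_eq_left] at h
    have := Nat.le_of_dvd (by omega) (orderOf_dvd_of_pow_eq_one h)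
    rw [hord] at this
    nlinarith [show 1 ≤ q - 1 by omega]

/-- The nonzero vectors on which the Hermitian form vanishes. -/
def hermitianCone (q : ℕ) (F : Type) [Field F] : Set (Fin 3 → F) :=
  {v | v ≠ 0 ∧ v 0 ^ (q + 1) + v 1 ^ (q + 1) + v 2 ^ (q + 1) = 0}

lemma mem_hermitianCone {q : ℕ} {F : Type} [Field F] {v : Fin 3 → F} :
    v ∈ hermitianCone q F ↔ v ≠ 0 ∧ v 0 ^ (q + 1) + v 1 ^ (q + 1) + v 2 ^ (q + 1) = 0 := Iff.rfl

lemma ncard_hermitianCone_le {F : Type} [Field F] [Fintype F] {q : ℕ} (hq : IsPrimePow q)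
    (hF : Fintype.card F = q ^ 2) :
    (hermitianCone q F).ncard ≤ (q ^ 2 - 1) * ((q + 1) * q ^ 2) := by
  classical
  obtain ⟨-, ζ, ξ, hζ, hξ, hne⟩ := exists_pow_eq_neg_one hq hF
  have hq2 := hq.two_le
  let B : Finset (F × F) := Finset.univ.erase 0
  have hB : B.card = q ^ 4 - 1 := by
    simp [B, Finset.card_erase_of_mem, hF]; ring_nf
  let U : Finset F := Finset.univ.erase 0
  have hU : U.card = q ^ 2 - 1 := by simp [U, Finset.card_erase_of_mem, hF]
  let Z : Finset (F × F) := U.image (fun u => (ζ * u, u)) ∪ U.image (fun u => (ξ * u, u))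
  have hZ : Z.card = 2 * (q ^ 2 - 1) := by
    rw [Finset.card_union_of_disjoint, Finset.card_image_of_injective,
      Finset.card_image_of_injective, hU, two_mul]
    · intro a b h; exact (Prod.ext_iff.1 h).2
    · intro a b h; exact (Prod.ext_iff.1 h).2
    · rw [Finset.disjoint_left]
      rintro _ h1 h2
      obtain ⟨u, hu, rfl⟩ := Finset.mem_image.1 h1
      obtain ⟨w, hw, h⟩ := Finset.mem_image.1 h2
      simp only [Prod.mk.injEq] at h
      obtain ⟨h, rfl⟩ := h
      exact hne (mul_right_cancel₀ (by simpa [U] using hu) h).symm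
  have hZB : Z ⊆ B := by
    intro p hp
    simp only [Z, U, Finset.mem_union, Finset.mem_image, Finset.mem_erase, Finset.mem_univ,
      and_true] at hp
    simp only [B, Finset.mem_erase, Finset.mem_univ, and_true]
    rintro rfl
    rcases hp with ⟨u, hu, h⟩ | ⟨u, hu, h⟩ <;> exact hu (Prod.ext_iff.1 h).2
  have hZ0 : ∀ p ∈ Z, p.1 ^ (q + 1) + p.2 ^ (q + 1) = 0 := by
    intro p hp
    simp only [Z, Finset.mem_union, Finset.mem_image] at hp
    rcases hp with ⟨u, hu, rfl⟩ | ⟨u, hu, rfl⟩ <;> simp [mul_pow, hζ, hξ]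
  let C : Finset (Fin 3 → F) := Finset.univ.filter (· ∈ hermitianCone q F)
  have memC : ∀ v, v ∈ C ↔ v ≠ 0 ∧ v 0 ^ (q + 1) + v 1 ^ (q + 1) + v 2 ^ (q + 1) = 0 := by
    intro v
    rw [← mem_hermitianCone]
    simp [C]
  have hC : (hermitianCone q F).ncard = C.card := by
    rw [← Set.ncard_coe_finset]; congr 1; ext; simp [C]
  let π : (Fin 3 → F) → F × F := fun v => (v 1, v 2)
  have hmaps : ∀ v ∈ C, π v ∈ B := by
    intro v hv
    rw [memC] at hv
    simp only [B, π, Finset.mem_erase, Finset.mem_univ, and_true]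
    intro h
    obtain ⟨h1, h2⟩ := Prod.ext_iff.1 h
    simp only [Prod.fst_zero, Prod.snd_zero] at h1 h2
    have h0 := hv.2
    simp [h1, h2] at h0
    exact hv.1 (by ext i; fin_cases i <;> simp [h0, h1, h2])
  have hfib : ∀ p ∈ B, (C.filter (π · = p)).card ≤
      (Polynomial.nthRoots (q + 1) (-(p.1 ^ (q + 1) + p.2 ^ (q + 1)))).toFinset.card := by
    intro p _
    refine Finset.card_le_card_of_injOn (fun v => v 0) ?_ ?_
    · intro v hv
      rw [Finset.mem_coe, Finset.mem_filter, memC] at hv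
      obtain ⟨⟨-, hv⟩, rfl⟩ := hv
      simp only [Finset.mem_coe, Multiset.mem_toFinset,
        Polynomial.mem_nthRoots (Nat.add_pos_right q one_pos)]
      linear_combination hv
    · intro v hv w hw h
      rw [Finset.mem_coe, Finset.mem_filter] at hv hw
      obtain ⟨h1, h2⟩ := Prod.ext_iff.1 (hv.2.trans hw.2.symm)
      ext i; fin_cases i
      · exact h
      · exact h1
      · exact h2
  have hle : C.card ≤ ∑ p ∈ B, if p ∈ Z then 1 else (q + 1) := by
    rw [Finset.card_eq_sum_card_fiberwise hmaps]
    refine Finset.sum_le_sum fun p hp => (hfib p hp).trans ?_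
    split_ifs with h
    · rw [hZ0 p h, neg_zero, Finset.card_le_one]
      intro a ha b hb
      rw [Multiset.mem_toFinset, Polynomial.mem_nthRoots q.succ_pos] at ha hb
      rw [eq_zero_of_pow_eq_zero ha, eq_zero_of_pow_eq_zero hb]
    · exact (Multiset.toFinset_card_le _).trans (Polynomial.card_nthRoots _ _)
  rw [hC]
  refine hle.trans ?_
  rw [← Finset.sum_sdiff hZB, Finset.sum_ite_of_false (fun p hp => (Finset.mem_sdiff.1 hp).2),
    Finset.sum_ite_of_true (fun p hp => hp), Finset.sum_const, Finset.sum_const,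
    Finset.card_sdiff_of_subset hZB, hB, hZ]
  obtain ⟨A, hA⟩ := Nat.exists_eq_add_of_le' (Nat.one_le_pow 2 q (by omega))
  have h4 : q ^ 4 - 1 - 2 * A = A * A := by
    rw [show q ^ 4 = (q ^ 2) ^ 2 by ring, hA, Nat.sub_sub]
    apply Nat.sub_eq_of_eq_add
    ring
  rw [show q ^ 2 - 1 = A by omega, h4, hA]
  simp only [smul_eq_mul]
  nlinarith

lemma isHomogeneous_hermitianForm (F : Type) [Field F] (q : ℕ) :
    (hermitianForm F q).IsHomogeneous (q + 1) :=
  ((isHomogeneous_X_pow 0 (q + 1)).add (isHomogeneous_X_pow 1 (q + 1))).add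
    (isHomogeneous_X_pow 2 (q + 1))

lemma eval_hermitianForm {F : Type} [Field F] (q : ℕ) (v : Fin 3 → F) :
    eval v (hermitianForm F q) = v 0 ^ (q + 1) + v 1 ^ (q + 1) + v 2 ^ (q + 1) := by
  simp [hermitianForm]

lemma eval_smul_of_isHomogeneous {R σ : Type*} [CommSemiring R] {f : MvPolynomial σ R} {m : ℕ}
    (hf : f.IsHomogeneous m) (t : R) (v : σ → R) : eval (t • v) f = t ^ m * eval v f := by
  rw [eval_eq, eval_eq, Finset.mul_sum]
  refine Finset.sum_congr rfl fun d hd => ?_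
  have : ∑ i ∈ d.support, d i = m := (hf.degree_eq_sum_deg_support hd).symm
  simp only [Pi.smul_apply, smul_eq_mul, mul_pow, Finset.prod_mul_distrib]
  rw [Finset.prod_pow_eq_pow_sum, this]
  ring

lemma smul_mem_hermitianCone {F : Type} [Field F] {q : ℕ} {t : F} (ht : t ≠ 0) {v : Fin 3 → F}
    (hv : v ∈ hermitianCone q F) : t • v ∈ hermitianCone q F := by
  rw [mem_hermitianCone, ← eval_hermitianForm] at hv ⊢
  refine ⟨smul_ne_zero ht hv.1, ?_⟩
  rw [eval_smul_of_isHomogeneous (isHomogeneous_hermitianForm F q), hv.2, mul_zero]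

/-- Bézout for the Hermitian curve, counted on the cone over it. -/
lemma card_zeros_on_hermitianCone_le {F : Type} [Field F] [Fintype F] {q : ℕ} (hq : IsPrimePow q)
    (hF : Fintype.card F = q ^ 2) {m : ℕ} (hm : m ≤ q) {f : MvPolynomial (Fin 3) F} (hf0 : f ≠ 0)
    (hf : f.IsHomogeneous m) (B : Finset (Fin 3 → F))
    (hB : ∀ v ∈ B, v ∈ hermitianCone q F ∧ eval v f = 0) :
    B.card ≤ (q ^ 2 - 1) * (m * (q + 1)) := by
  classical
  obtain ⟨hq0, ζ, -, hζ, -⟩ := exists_pow_eq_neg_one hq hF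
  have hirr := irreducible_hermitianForm hq0 hζ
  have hdvd : ¬ hermitianForm F q ∣ f := by
    rintro ⟨c, hc⟩
    have hc0 : c ≠ 0 := by rintro rfl; exact hf0 (by simpa using hc)
    have h1 := totalDegree_mul_of_isDomain hirr.ne_zero hc0
    rw [← hc, hf.totalDegree hf0,
      (isHomogeneous_hermitianForm F q).totalDegree hirr.ne_zero] at h1
    omega
  have : Fintype (Projectivization F (Fin 3 → F)) := Fintype.ofFinite _
  let T : Finset (Projectivization F (Fin 3 → F)) :=
    Finset.univ.filter fun P => eval P.rep f = 0 ∧ eval P.rep (hermitianForm F q) = 0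
  have hT : T.card ≤ m * (q + 1) :=
    card_common_zeros_le hf (isHomogeneous_hermitianForm F q) hirr hdvd T
      fun P hP => (Finset.mem_filter.1 hP).2
  let U : Finset F := Finset.univ.erase 0
  have hU : U.card = q ^ 2 - 1 := by simp [U, Finset.card_erase_of_mem, hF]
  have hsub : B ⊆ T.biUnion fun P => U.image fun t => t • P.rep := by
    intro v hv
    obtain ⟨hvC, hvf⟩ := hB v hv
    rw [mem_hermitianCone, ← eval_hermitianForm] at hvC
    obtain ⟨a, ha⟩ := Projectivization.exists_smul_eq_mk_rep F v hvC.1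
    rw [Units.smul_def] at ha
    refine Finset.mem_biUnion.2 ⟨Projectivization.mk F v hvC.1, ?_, ?_⟩
    · refine Finset.mem_filter.2 ⟨Finset.mem_univ _, ?_, ?_⟩
      · rw [← ha, eval_smul_of_isHomogeneous hf, hvf, mul_zero]
      · rw [← ha, eval_smul_of_isHomogeneous (isHomogeneous_hermitianForm F q), hvC.2, mul_zero]
    · refine Finset.mem_image.2 ⟨(a⁻¹ : Fˣ), by simp [U], ?_⟩
      rw [← ha, smul_smul, Units.inv_mul, one_smul]
  refine (Finset.card_le_card hsub).trans ((Finset.card_biUnion_le_card_mul _ _ (q ^ 2 - 1)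
    fun P _ => Finset.card_image_le.trans hU.le).trans ?_)
  rw [mul_comm]
  exact Nat.mul_le_mul_left _ hT

/-- A polynomial of degree at most `e` whose components below degree `m` vanish has, along each
line through the origin, at most `e - m` nonzero roots or vanishes on the whole line. -/
lemma card_zeros_on_line_le {F : Type} [Field F] {g : MvPolynomial (Fin 3) F} {m k : ℕ}
    (hg : g.totalDegree ≤ m + k) (hlow : ∀ i < m, homogeneousComponent i g = 0) (v : Fin 3 → F)
    (hv : ∃ i, eval v (homogeneousComponent i g) ≠ 0) (T : Finset F)
    (hT : ∀ t ∈ T, t ≠ 0 ∧ eval (t • v) g = 0) : T.card ≤ k := by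
  classical
  let R : Polynomial F := ∑ j ∈ Finset.range (k + 1),
    Polynomial.C (eval v (homogeneousComponent (m + j) g)) * Polynomial.X ^ j
  have hcoeff : ∀ j ≤ k, R.coeff j = eval v (homogeneousComponent (m + j) g) := by
    intro j hj
    simp [R, Polynomial.finsetSum_coeff, Polynomial.coeff_X_pow, hj]
  have hR : R ≠ 0 := by
    obtain ⟨i, hi⟩ := hv
    have him : m ≤ i := by
      by_contra! h
      exact hi (by rw [hlow i h, map_zero])
    obtain ⟨j, rfl⟩ := Nat.exists_eq_add_of_le him
    have hj : j ≤ k := by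
      by_contra! h
      exact hi (by rw [homogeneousComponent_eq_zero _ _ (by omega), map_zero])
    intro h0
    rw [← hcoeff j hj, h0] at hi
    simp at hi
  have hdeg : R.natDegree ≤ k := by
    refine Polynomial.natDegree_sum_le_of_forall_le _ _ fun j hj => ?_
    exact (Polynomial.natDegree_C_mul_X_pow_le _ _).trans (Nat.lt_succ_iff.1 (Finset.mem_range.1 hj))
  have heval : ∀ t, eval (t • v) g = t ^ m * R.eval t := by
    intro t
    have h1 : g = ∑ i ∈ Finset.range (m + (k + 1)), homogeneousComponent i g := by
      conv_lhs => rw [← sum_homogeneousComponent g]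
      refine Finset.sum_subset (Finset.range_mono (by omega)) fun i _ hi => ?_
      exact homogeneousComponent_eq_zero _ _ (by simpa using hi)
    conv_lhs => rw [h1]
    rw [Finset.sum_range_add, Finset.sum_eq_zero (fun i hi => hlow i (Finset.mem_range.1 hi)),
      zero_add, map_sum, Polynomial.eval_finsetSum, Finset.mul_sum]
    refine Finset.sum_congr rfl fun j _ => ?_
    rw [eval_smul_of_isHomogeneous (homogeneousComponent_isHomogeneous _ _)]
    simp only [Polynomial.eval_mul, Polynomial.eval_C, Polynomial.eval_pow, Polynomial.eval_X]
    ring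
  refine (Finset.card_le_card (t := R.roots.toFinset) fun t ht => ?_).trans
    ((Multiset.toFinset_card_le _).trans ((Polynomial.card_roots' R).trans hdeg))
  obtain ⟨ht0, ht⟩ := hT t ht
  rw [Multiset.mem_toFinset, Polynomial.mem_roots hR, Polynomial.IsRoot]
  rw [heval] at ht
  exact (mul_eq_zero.1 ht).resolve_left (pow_ne_zero _ ht0)

lemma ncard_affine_zeros_le {F : Type} [Field F] [Fintype F] {q : ℕ} (hq : IsPrimePow q)
    (hF : Fintype.card F = q ^ 2) {e : ℕ} (he : e ≤ q) {g : MvPolynomial (Fin 3) F} (hg0 : g ≠ 0)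
    (hg : g.totalDegree ≤ e) :
    {v : Fin 3 → F | v 0 ^ (q + 1) + v 1 ^ (q + 1) + v 2 ^ (q + 1) = 0 ∧ eval v g = 0}.ncard ≤
      e * (q + 1) * q ^ 2 := by
  classical
  have hq2 := hq.two_le
  have hex : ∃ i, homogeneousComponent i g ≠ 0 := by
    by_contra! h
    exact hg0 (by rw [← sum_homogeneousComponent g]; exact Finset.sum_eq_zero fun i _ => h i)
  let m := Nat.find hex
  have hm : homogeneousComponent m g ≠ 0 := Nat.find_spec hex
  have hlow : ∀ i < m, homogeneousComponent i g = 0 := fun i hi => by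
    simpa using Nat.find_min hex hi
  have hme : m ≤ e := by
    by_contra! h
    exact hm (homogeneousComponent_eq_zero _ _ (by omega))
  clear_value m
  obtain ⟨k, rfl⟩ := Nat.exists_eq_add_of_le hme
  obtain ⟨A, hA⟩ := Nat.exists_eq_add_of_le' (Nat.one_le_pow 2 q (by omega))
  have hkA : k ≤ A := by nlinarith
  let U : Finset F := Finset.univ.erase 0
  have hU : U.card = A := by simp [U, Finset.card_erase_of_mem, hF, hA]
  let C : Finset (Fin 3 → F) := Finset.univ.filter (· ∈ hermitianCone q F)
  have memC : ∀ v, v ∈ C ↔ v ∈ hermitianCone q F := by simp [C]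
  have hC : C.card ≤ A * ((q + 1) * q ^ 2) := by
    have := ncard_hermitianCone_le hq hF
    rw [show q ^ 2 - 1 = A by omega] at this
    convert this
    rw [← Set.ncard_coe_finset]; congr 1; ext; simp [C]
  let B : Finset (Fin 3 → F) := C.filter fun v => ∀ i, eval v (homogeneousComponent i g) = 0
  have hB : B.card ≤ A * (m * (q + 1)) := by
    have := card_zeros_on_hermitianCone_le hq hF (by omega : m ≤ q) hm
      (homogeneousComponent_isHomogeneous m g) B fun v hv => by
        rw [Finset.mem_filter, memC] at hv
        exact ⟨hv.1, hv.2 m⟩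
    rwa [show q ^ 2 - 1 = A by omega] at this
  let N : Finset (Fin 3 → F) := C.filter fun v => eval v g = 0
  have hlower : A * N.card ≤ ∑ t ∈ U, (C.filter fun v => eval (t • v) g = 0).card := by
    rw [← hU, ← smul_eq_mul]
    refine Finset.card_nsmul_le_sum _ _ _ fun t ht => ?_
    have ht0 : t ≠ 0 := by simpa [U] using ht
    refine Finset.card_le_card_of_injOn (fun v => t⁻¹ • v) ?_ ?_
    · intro v hv
      rw [Finset.mem_coe, Finset.mem_filter, memC] at hv
      rw [Finset.mem_coe, Finset.mem_filter, memC]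
      exact ⟨smul_mem_hermitianCone (inv_ne_zero ht0) hv.1, by rw [smul_inv_smul₀ ht0]; exact hv.2⟩
    · exact fun v _ w _ h => smul_right_injective _ (inv_ne_zero ht0) h
  have hupper : ∑ t ∈ U, (C.filter fun v => eval (t • v) g = 0).card ≤
      C.card * k + B.card * (A - k) := by
    calc _ = ∑ v ∈ C, (U.filter fun t => eval (t • v) g = 0).card := by
          simp only [Finset.card_filter]
          exact Finset.sum_comm
      _ ≤ ∑ v ∈ C, (k + if ∀ i, eval v (homogeneousComponent i g) = 0 then A - k else 0) := by
          refine Finset.sum_le_sum fun v _ => ?_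
          split_ifs with h
          · rw [Nat.add_sub_cancel' hkA, ← hU]
            exact Finset.card_filter_le _ _
          · refine card_zeros_on_line_le hg hlow v (by simpa using h) _ fun t ht => ?_
            simpa [U] using ht
      _ = _ := by
          rw [Finset.sum_add_distrib, Finset.sum_const, ← Finset.sum_filter, Finset.sum_const,
            smul_eq_mul, smul_eq_mul]
  have hApos : 0 < A := by nlinarith
  have hN : N.card ≤ (q + 1) * q ^ 2 * k + m * (q + 1) * (A - k) := by
    refine Nat.le_of_mul_le_mul_left (hlower.trans (hupper.trans ?_)) hApos
    calc _ ≤ A * ((q + 1) * q ^ 2) * k + A * (m * (q + 1)) * (A - k) := by gcongr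
      _ = _ := by ring
  rcases Nat.eq_zero_or_pos m with rfl | hmpos
  · have hsub : {v : Fin 3 → F | v 0 ^ (q + 1) + v 1 ^ (q + 1) + v 2 ^ (q + 1) = 0 ∧
        eval v g = 0} ⊆ (N : Set (Fin 3 → F)) := by
      rintro v ⟨hv, hvg⟩
      rw [Finset.mem_coe, Finset.mem_filter, memC, mem_hermitianCone]
      refine ⟨⟨?_, hv⟩, hvg⟩
      rintro rfl
      apply hm
      rw [eval_zero, constantCoeff_eq] at hvg
      rw [homogeneousComponent_zero, hvg, map_zero]
    refine (Set.ncard_le_ncard hsub).trans ?_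
    rw [Set.ncard_coe_finset]
    refine hN.trans (le_of_eq ?_)
    ring
  · have hsub : {v : Fin 3 → F | v 0 ^ (q + 1) + v 1 ^ (q + 1) + v 2 ^ (q + 1) = 0 ∧
        eval v g = 0} ⊆ ((insert 0 N : Finset (Fin 3 → F)) : Set (Fin 3 → F)) := by
      rintro v ⟨hv, hvg⟩
      rw [Finset.mem_coe, Finset.mem_insert, Finset.mem_filter, memC, mem_hermitianCone]
      by_cases h0 : v = 0
      · exact Or.inl h0
      · exact Or.inr ⟨⟨h0, hv⟩, hvg⟩
    refine (Set.ncard_le_ncard hsub).trans ?_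
    rw [Set.ncard_coe_finset]
    refine (Finset.card_insert_le _ _).trans ?_
    have h1 : m * (q + 1) * (A - k) ≤ m * (q + 1) * A := Nat.mul_le_mul_left _ (Nat.sub_le _ _)
    have h2 : 1 ≤ m * (q + 1) := Nat.mul_pos hmpos q.succ_pos
    have h3 : (m + k) * (q + 1) * q ^ 2 = (q + 1) * q ^ 2 * k + (m * (q + 1) * A + m * (q + 1)) := by
      rw [hA]; ring
    omega

/-- Dehomogenisation with respect to the plane `x₃ = ℓ(x₀, x₁, x₂)` substitutes `p` for `x₃`. -/
def substLast {F : Type} [Field F] (p : MvPolynomial (Fin 3) F) (G : MvPolynomial (Fin 4) F) :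
    MvPolynomial (Fin 3) F := aeval ![X 0, X 1, X 2, p] G

lemma eval_substLast {F : Type} [Field F] (p : MvPolynomial (Fin 3) F)
    (G : MvPolynomial (Fin 4) F) (v : Fin 3 → F) :
    eval v (substLast p G) = eval ![v 0, v 1, v 2, eval v p] G := by
  have h : (fun i => eval v ((![X 0, X 1, X 2, p] : Fin 4 → MvPolynomial (Fin 3) F) i)) =
      ![v 0, v 1, v 2, eval v p] := by
    ext i; fin_cases i <;> simp
  rw [substLast, ← h]
  induction G using MvPolynomial.induction_on with
  | C a => simp
  | add a b ha hb => simp only [map_add, ha, hb]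
  | mul_X a i ha => simp only [map_mul, ha, aeval_X, eval_X]

lemma isHomogeneous_substLast {F : Type} [Field F] {p : MvPolynomial (Fin 3) F}
    {G : MvPolynomial (Fin 4) F} {d : ℕ} (hp : p.IsHomogeneous 1) (hG : G.IsHomogeneous d) :
    (substLast p G).IsHomogeneous d := by
  have := hG.aeval (n := 1) (![X 0, X 1, X 2, p] : Fin 4 → MvPolynomial (Fin 3) F) fun i => by
    fin_cases i
    · exact isHomogeneous_X _ _
    · exact isHomogeneous_X _ _
    · exact isHomogeneous_X _ _
    · exact hp
  rwa [one_mul] at this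

lemma totalDegree_one_add_pow_sub_pow_le {F : Type} [Field F] {l : MvPolynomial (Fin 3) F}
    (hl : l.totalDegree ≤ 1) (a : ℕ) : ((1 + l) ^ (a + 1) - l ^ (a + 1)).totalDegree ≤ a := by
  have hl' : (1 + l).totalDegree ≤ 1 := (totalDegree_add _ _).trans (by simp [hl])
  rw [← (Commute.all (1 + l) l).geom_sum₂_mul, add_sub_cancel_right, mul_one]
  refine totalDegree_finsetSum_le fun i hi => ?_
  have hi := Finset.mem_range.1 hi
  refine (totalDegree_mul _ _).trans ?_
  have h1 := (totalDegree_pow (1 + l) i).trans (Nat.mul_le_mul_left i hl')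
  have h2 := (totalDegree_pow l (a + 1 - 1 - i)).trans (Nat.mul_le_mul_left _ hl)
  omega

lemma totalDegree_substLast_sub_le {F : Type} [Field F] {l : MvPolynomial (Fin 3) F}
    {G : MvPolynomial (Fin 4) F} {d : ℕ} (hl : l.totalDegree ≤ 1) (hG : G.IsHomogeneous d) :
    (substLast (1 + l) G - substLast l G).totalDegree ≤ d - 1 := by
  simp only [substLast, aeval_def, eval₂_eq', ← Finset.sum_sub_distrib, Fin.prod_univ_four,
    Matrix.cons_val, ← mul_sub]
  refine totalDegree_finsetSum_le fun α hα => ?_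
  have hd : α 0 + α 1 + α 2 + α 3 = d := by
    have := hG.degree_eq_sum_deg_support hα
    rw [← Finsupp.degree_apply, Finsupp.degree_eq_sum, Fin.sum_univ_four] at this
    exact this.symm
  rcases h3 : α 3 with _ | a
  · simp
  · refine (totalDegree_mul _ _).trans ?_
    have h0 := totalDegree_one_add_pow_sub_pow_le hl a
    have h1 : (algebraMap F (MvPolynomial (Fin 3) F) (coeff α G)).totalDegree = 0 := by
      rw [algebraMap_eq, totalDegree_C]
    have h2 := totalDegree_mul
      ((X 0 : MvPolynomial (Fin 3) F) ^ α 0 * X 1 ^ α 1 * X 2 ^ α 2) ((1 + l) ^ (a + 1) - l ^ (a + 1))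
    have h4 := totalDegree_mul ((X 0 : MvPolynomial (Fin 3) F) ^ α 0 * X 1 ^ α 1) (X 2 ^ α 2)
    have h5 := totalDegree_mul ((X 0 : MvPolynomial (Fin 3) F) ^ α 0) (X 1 ^ α 1)
    simp only [totalDegree_X_pow] at h4 h5
    omega

lemma IsPlane3.exists_dual {F : Type} [Field F] {S : Set (P3 F)} (hS : IsPlane3 F S)
    (hP0 : vertexP0 F ∉ S) : ∃ φ : Module.Dual F (Fin 4 → F), φ (Pi.single 3 1) = 1 ∧
      ∀ x : P3 F, x ∈ S ↔ φ x.rep = 0 := by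
  obtain ⟨W, hW, rfl⟩ := hS
  have hmem : ∀ x : P3 F, x ∈ {x : P3 F | x.submodule ≤ W} ↔ x.rep ∈ W := by
    intro x
    change x.submodule ≤ W ↔ _
    rw [Projectivization.submodule_eq, Submodule.span_singleton_le_iff_mem]
  have he : (![0, 0, 0, 1] : Fin 4 → F) = Pi.single 3 1 := by
    ext i; fin_cases i <;> simp
  have h3 : (Pi.single 3 1 : Fin 4 → F) ∉ W := by
    intro h
    apply hP0
    change (vertexP0 F).submodule ≤ W
    rw [vertexP0, Projectivization.submodule_mk, Submodule.span_singleton_le_iff_mem, he]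
    exact h
  obtain ⟨f, hf, hfW⟩ := Submodule.exists_dual_map_eq_bot_of_notMem h3 inferInstance
  have hle : W ≤ LinearMap.ker f := fun x hx => by
    have := Submodule.mem_map_of_mem (f := f) hx
    rwa [hfW, Submodule.mem_bot] at this
  have hker : W = LinearMap.ker f := by
    refine Submodule.eq_of_le_of_finrank_eq hle ?_
    have := Module.Dual.finrank_ker_add_one_of_ne_zero (f := f) (by rintro rfl; simp at hf)
    rw [Module.finrank_fin_fun] at this
    omega
  refine ⟨(f (Pi.single 3 1))⁻¹ • f, by simp [hf], fun x => ?_⟩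
  rw [hmem, hker, LinearMap.mem_ker]
  simp [hf]

theorem stmt4 (q : ℕ) (hq : IsPrimePow q)
    (F : Type) [Field F] [Fintype F] (hF : Fintype.card F = q ^ 2)
    (d : ℕ) (hd1 : 1 ≤ d) (hdq : d ≤ q)
    (G : MvPolynomial (Fin 4) F) (hG : G ≠ 0) (hGd : G.IsHomogeneous d)
    (Pl : Set (P3 F)) (hPl : IsPlane3 F Pl)
    (hP0 : vertexP0 F ∉ Pl) (hPlG : Pl ⊆ VG3 G) :
    (VG3 G ∩ hermV2' q F ∩ (Set.univ \ Pl)).ncard ≤ (d - 1) * (q + 1) * q ^ 2 := by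
  obtain ⟨φ, hφ3, hφ⟩ := hPl.exists_dual hP0
  have hq2 := hq.two_le
  have hdF : (d : Cardinal) ≤ Cardinal.mk F := by
    rw [Cardinal.mk_fintype, hF]
    exact_mod_cast hdq.trans (Nat.le_self_pow two_ne_zero q)
  have hGφ : ∀ u : Fin 4 → F, φ u = 0 → eval u G = 0 := by
    intro u hu
    by_cases hu0 : u = 0
    · rw [hu0, ← zero_smul F (0 : Fin 4 → F), eval_smul_of_isHomogeneous hGd,
        zero_pow (by omega), zero_mul]
    · obtain ⟨a, ha⟩ := Projectivization.exists_smul_eq_mk_rep F u hu0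
      rw [Units.smul_def] at ha
      have hx : Projectivization.mk F u hu0 ∈ VG3 G :=
        hPlG ((hφ _).2 (by rw [← ha, map_smul, hu, smul_zero]))
      have hx : eval (Projectivization.mk F u hu0).rep G = 0 := hx
      rw [← ha, eval_smul_of_isHomogeneous hGd] at hx
      exact (mul_eq_zero.1 hx).resolve_left (pow_ne_zero _ a.ne_zero)
  let l : MvPolynomial (Fin 3) F := -∑ i, C (φ (Pi.single i.castSucc 1)) * X i
  have hl : l.IsHomogeneous 1 :=
    (IsHomogeneous.sum _ _ _ fun i _ => isHomogeneous_C_mul_X _ i).neg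
  have hφl : ∀ u : Fin 4 → F, φ u = u 3 - eval ![u 0, u 1, u 2] l := by
    intro u
    rw [← eval_linearForm φ u]
    have e0 : (Fin.castSucc 0 : Fin 4) = 0 := rfl
    have e1 : (Fin.castSucc 1 : Fin 4) = 1 := rfl
    have e2 : (Fin.castSucc 2 : Fin 4) = 2 := rfl
    simp only [linearForm, l, Fin.sum_univ_four, Fin.sum_univ_three, e0, e1, e2, hφ3, map_add,
      map_neg, map_mul, eval_C, eval_X, map_one, Matrix.cons_val]
    ring
  have hcons : ∀ u : Fin 4 → F, ![u 0, u 1, u 2, u 3] = u := by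
    intro u; ext i; fin_cases i <;> rfl
  -- points off the plane are represented by vectors with `φ u = 1`
  have heval1 : ∀ u : Fin 4 → F, φ u = 1 →
      eval ![u 0, u 1, u 2] (substLast (1 + l) G) = eval u G := by
    intro u hu
    have h3 : eval ![u 0, u 1, u 2] (1 + l) = u 3 := by
      rw [map_add, map_one, ← hu, hφl]; ring
    rw [eval_substLast, h3]
    exact congrArg (fun w => eval w G) (hcons u)
  have hl0 : substLast l G = 0 := by
    refine (isHomogeneous_substLast hl hGd).eq_zero_of_forall_eval_eq_zero_of_le_card ?_ hdF
    intro v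
    rw [eval_substLast]
    apply hGφ
    have hv : ![v 0, v 1, v 2] = v := by ext i; fin_cases i <;> rfl
    rw [hφl]
    simp [hv]
  have hdeg : (substLast (1 + l) G).totalDegree ≤ d - 1 := by
    have := totalDegree_substLast_sub_le hl.totalDegree_le hGd
    rwa [hl0, sub_zero] at this
  have hne : substLast (1 + l) G ≠ 0 := by
    intro h0
    refine hG (hGd.eq_zero_of_forall_eval_eq_zero_of_le_card (fun u => ?_) hdF)
    by_cases hu : φ u = 0
    · exact hGφ u hu
    · have h1 := heval1 ((φ u)⁻¹ • u) (by simp [hu])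
      rw [h0, map_zero, eval_smul_of_isHomogeneous hGd] at h1
      exact (mul_eq_zero.1 h1.symm).resolve_left (pow_ne_zero _ (inv_ne_zero hu))
  refine le_trans ?_ (ncard_affine_zeros_le hq hF (by omega : d - 1 ≤ q) hne hdeg)
  let r : P3 F → Fin 4 → F := fun x => (φ x.rep)⁻¹ • x.rep
  have hr : ∀ x ∉ Pl, φ (r x) = 1 := by
    intro x hx
    rw [hφ] at hx
    simp [r, hx]
  refine Set.ncard_le_ncard_of_injOn (fun x => ![r x 0, r x 1, r x 2]) ?_ ?_ (Set.toFinite _)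
  · rintro x ⟨⟨hxG, hxH⟩, -, hx⟩
    have hxG : eval x.rep G = 0 := hxG
    have hxH : x.rep 0 ^ (q + 1) + x.rep 1 ^ (q + 1) + x.rep 2 ^ (q + 1) = 0 := hxH
    refine ⟨?_, ?_⟩
    · simp only [r, Pi.smul_apply, smul_eq_mul, Matrix.cons_val, mul_pow, ← mul_add, hxH, mul_zero]
    · rw [heval1 _ (hr x hx), eval_smul_of_isHomogeneous hGd, hxG, mul_zero]
  · rintro x ⟨-, -, hx⟩ y ⟨-, -, hy⟩ hxy
    have hxy : ![r x 0, r x 1, r x 2] = ![r y 0, r y 1, r y 2] := hxy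
    have h3 : r x 3 = r y 3 := by
      have h1 := hr x hx
      have h2 := hr y hy
      rw [hφl, hxy] at h1
      rw [hφl] at h2
      exact sub_left_injective (h1.trans h2.symm)
    have hrxy : r x = r y := by
      ext i; fin_cases i
      · exact congrFun hxy 0
      · exact congrFun hxy 1
      · exact congrFun hxy 2
      · exact h3
    have hx0 : φ x.rep ≠ 0 := fun h => hx ((hφ x).2 h)
    rw [← x.mk_rep, ← y.mk_rep, Projectivization.mk_eq_mk_iff']
    refine ⟨φ x.rep * (φ y.rep)⁻¹, ?_⟩
    rw [mul_smul]
    change φ x.rep • r y = x.rep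
    rw [← hrxy, smul_inv_smul₀ hx0]
end
end

section
/- Let q be a prime power, F a finite field with q^2 elements, 1 < d ≤ q, and G ∈ F[x_0,...,x_4] a nonzero homogeneous polynomial of degree d. If no generator of V_3 is contained in V(G)(F), then |V(G)(F) ∩ V_3| ≤ d(q^5 + 1); in particular |V(G)(F) ∩ V_3| < d(q^5 + q^2) + q^3 + 1. -/
open MvPolynomial

noncomputable section

/-- The projective space ℙ⁴(F): 1-dimensional F-linear subspaces of F⁵. -/
abbrev P4 (F : Type) [Field F] := Projectivization F (Fin 5 → F)

/-- The non-degenerate Hermitian threefold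
    V₃ = {[x] ∈ ℙ⁴(F) : x₀^{q+1} + ⋯ + x₄^{q+1} = 0}. -/
def hermV3 (q : ℕ) (F : Type) [Field F] : Set (P4 F) :=
  {x | ∑ i, x.rep i ^ (q + 1) = 0}

/-- V(G)(F) = {[x] ∈ ℙ⁴(F) : G(x) = 0}, for G homogeneous this is well defined. -/
def VG {F : Type} [Field F] (G : MvPolynomial (Fin 5) F) : Set (P4 F) :=
  {x | eval x.rep G = 0}

/-- The set of points of ℙ⁴(F) contained in an F-linear subspace of F⁵ of dimension k. -/
def IsLinSub (F : Type) [Field F] (k : ℕ) (S : Set (P4 F)) : Prop :=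
  ∃ W : Submodule F (Fin 5 → F), Module.finrank F W = k ∧
    S = {x : P4 F | x.submodule ≤ W}

/-- A line of ℙ⁴(F). -/
def IsLine (F : Type) [Field F] (S : Set (P4 F)) : Prop := IsLinSub F 2 S

/-- A plane of ℙ⁴(F). -/
def IsPlane (F : Type) [Field F] (S : Set (P4 F)) : Prop := IsLinSub F 3 S

/-- A hyperplane of ℙ⁴(F). -/
def IsHyperplane (F : Type) [Field F] (S : Set (P4 F)) : Prop := IsLinSub F 4 S

/-- The tangent hyperplane T_P(V₃) = {[x] : a₀^q x₀ + ⋯ + a₄^q x₄ = 0} where P = [a]. -/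
def tangentHyp (q : ℕ) {F : Type} [Field F] (P : P4 F) : Set (P4 F) :=
  {x | ∑ i, P.rep i ^ q * x.rep i = 0}

/-- A subset of ℙ⁴(F) is a tangent hyperplane to V₃ if it equals T_P(V₃) for some P ∈ V₃. -/
def IsTangentHyp (q : ℕ) {F : Type} [Field F] (S : Set (P4 F)) : Prop :=
  ∃ P ∈ hermV3 q F, S = tangentHyp q P

/-- If a map from a set of size `a * b` to a set of size at most `b` has all fibres of size at
most `a`, then all its fibres have size exactly `a`. -/
theorem card_fiber_eq_of_le {α β : Type*} [DecidableEq β] {s : Finset α} {t : Finset β}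
    {f : α → β} (hf : ∀ x ∈ s, f x ∈ t) {a b : ℕ} (hs : s.card = a * b) (ht : t.card ≤ b)
    (hfib : ∀ c ∈ t, (s.filter (fun x => f x = c)).card ≤ a) :
    ∀ c ∈ t, (s.filter (fun x => f x = c)).card = a := by
  have h1 := Finset.card_eq_sum_card_fiberwise (f := f) (s := s) (t := t) hf
  have h2 : ∑ c ∈ t, (s.filter (fun x => f x = c)).card ≤ ∑ _c ∈ t, a := Finset.sum_le_sum hfib
  have h3 : ∑ _c ∈ t, a ≤ a * b := by
    rw [Finset.sum_const, smul_eq_mul, mul_comm]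
    exact Nat.mul_le_mul_left a ht
  exact (Finset.sum_eq_sum_iff_of_le hfib).1 (le_antisymm h2 (by omega))

section FiniteFields

variable {F : Type} [Field F] [Fintype F] [DecidableEq F]

theorem card_filter_eval_eq_zero_le {p : Polynomial F} (hp : p ≠ 0) :
    (Finset.univ.filter (fun x => p.eval x = 0)).card ≤ p.natDegree := by
  apply Polynomial.card_le_degree_of_subset_roots
  intro x hx
  simpa [hp] using hx

theorem card_filter_pow_eq_le {n : ℕ} (hn : 0 < n) (c : F) :
    (Finset.univ.filter (fun x : F => x ^ n = c)).card ≤ n := by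
  have h := card_filter_eval_eq_zero_le (Polynomial.X_pow_sub_C_ne_zero hn c)
  simpa [sub_eq_zero] using h

/-- Over the field with `q ^ 2` elements, the norm takes each nonzero value `q + 1` times. -/
theorem card_norm_fiber {q : ℕ} (hq : 1 < q) (hF : Fintype.card F = q ^ 2) {c : F}
    (hc : c ≠ 0) (hcq : c ^ q = c) :
    (Finset.univ.filter (fun x : F => x ^ (q + 1) = c)).card = q + 1 := by
  have hcard : q ^ 2 - 1 = (q + 1) * (q - 1) := by
    simpa using Nat.sq_sub_sq q 1
  have key := card_fiber_eq_of_le (s := Finset.univ.filter (fun x : F => x ≠ 0))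
    (t := Finset.univ.filter (fun x : F => x ^ (q - 1) = 1)) (f := fun x => x ^ (q + 1))
    (a := q + 1) (b := q - 1)
    (by
      intro x hx
      have hx0 : x ≠ 0 := by simpa using hx
      simp only [Finset.mem_filter, Finset.mem_univ, true_and]
      rw [← pow_mul, ← hcard, ← hF]
      exact FiniteField.pow_card_sub_one_eq_one x hx0)
    (by
      rw [Finset.filter_ne' Finset.univ (0 : F), Finset.card_erase_of_mem (Finset.mem_univ _),
        Finset.card_univ, hF, hcard])
    (card_filter_pow_eq_le (by omega) 1)
    (by
      intro c _
      refine le_trans (Finset.card_le_card ?_) (card_filter_pow_eq_le (Nat.succ_pos q) c)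
      intro x hx
      simp only [Finset.mem_filter, Finset.mem_univ, true_and] at hx ⊢
      exact hx.2)
    c (by
      simp only [Finset.mem_filter, Finset.mem_univ, true_and]
      apply mul_right_cancel₀ hc
      rw [← pow_succ, one_mul, Nat.sub_add_cancel hq.le, hcq])
  refine Eq.trans (congrArg Finset.card ?_) key
  ext x
  simp only [Finset.mem_filter, Finset.mem_univ, true_and]
  constructor
  · intro h
    refine ⟨?_, h⟩
    rintro rfl
    exact hc (by rw [← h]; simp)
  · exact fun h => h.2

/-- Over the field with `q ^ 2` elements, the trace takes each value `q` times. -/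
theorem card_trace_fiber {q : ℕ} (hq : 1 < q) (hF : Fintype.card F = q ^ 2) {σ : F →+* F}
    (hσ : ∀ x, σ x = x ^ q) {c : F} (hcq : c ^ q = c) :
    (Finset.univ.filter (fun x : F => x ^ q + x = c)).card = q := by
  have key := card_fiber_eq_of_le (s := (Finset.univ : Finset F))
    (t := Finset.univ.filter (fun x : F => x ^ q = x)) (f := fun x => x ^ q + x)
    (a := q) (b := q)
    (by
      intro x _
      simp only [Finset.mem_filter, Finset.mem_univ, true_and]
      rw [← hσ (x ^ q + x), map_add, hσ, hσ, ← pow_mul, ← sq, ← hF, FiniteField.pow_card, add_comm])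
    (by rw [Finset.card_univ, hF, sq])
    (by
      have h := card_filter_eval_eq_zero_le (F := F) (FiniteField.X_pow_card_sub_X_ne_zero F hq)
      rw [FiniteField.X_pow_card_sub_X_natDegree_eq F hq] at h
      simpa [sub_eq_zero] using h)
    (by
      intro c _
      have hdeg : (Polynomial.X - Polynomial.C c : Polynomial F).degree < (q : WithBot ℕ) := by
        rw [Polynomial.degree_X_sub_C]
        exact_mod_cast hq
      have h := card_filter_eval_eq_zero_le (F := F)
        (Polynomial.monic_X_pow_add hdeg).ne_zero
      rw [Polynomial.natDegree_eq_of_degree_eq_some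
        (Polynomial.degree_add_eq_left_of_degree_lt (by rwa [Polynomial.degree_X_pow]) |>.trans
          (Polynomial.degree_X_pow q))] at h
      simpa [sub_eq_zero, ← add_sub_assoc] using h)
    c (by simpa using hcq)
  exact key

end FiniteFields

/-- The Hermitian form `∑ i, σ (x i) * y i`. -/
def hermForm {F : Type} [Field F] (σ : F →+* F) {n : ℕ} (x : Fin n → F) :
    (Fin n → F) →ₗ[F] F where
  toFun y := ∑ i, σ (x i) * y i
  map_add' y z := by simp [mul_add, Finset.sum_add_distrib]
  map_smul' a y := by
    simp only [Pi.smul_apply, smul_eq_mul, Finset.mul_sum, RingHom.id_apply]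
    exact Finset.sum_congr rfl fun i _ => by ring

section HermForm

variable {F : Type} [Field F] {σ : F →+* F} {n : ℕ}

theorem hermForm_apply (x y : Fin n → F) : hermForm σ x y = ∑ i, σ (x i) * y i := rfl

theorem hermForm_add_left (x y z : Fin n → F) :
    hermForm σ (x + y) z = hermForm σ x z + hermForm σ y z := by
  simp [hermForm_apply, add_mul, Finset.sum_add_distrib]

theorem hermForm_smul_left (a : F) (x y : Fin n → F) :
    hermForm σ (a • x) y = σ a * hermForm σ x y := by
  simp [hermForm_apply, Finset.mul_sum, mul_assoc]

theorem map_hermForm (hσσ : ∀ a, σ (σ a) = a) (x y : Fin n → F) :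
    σ (hermForm σ x y) = hermForm σ y x := by
  simp [hermForm_apply, hσσ, mul_comm]

theorem hermForm_ne_zero {x : Fin n → F} (hx : x ≠ 0) : hermForm σ x ≠ 0 := by
  intro h
  obtain ⟨i, hi⟩ := Function.ne_iff.1 hx
  have := LinearMap.congr_fun h (Pi.single i 1)
  simp [hermForm_apply, Pi.single_apply] at this
  exact hi this

end HermForm

section Counting

variable {F : Type} [Field F] [Fintype F] {q : ℕ} {σ : F →+* F}

theorem map_map_eq_self (hF : Fintype.card F = q ^ 2) (hσ : ∀ x, σ x = x ^ q) (a : F) :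
    σ (σ a) = a := by
  rw [hσ, hσ, ← pow_mul, ← sq, ← hF, FiniteField.pow_card]

variable [DecidableEq F]

variable (σ) in
/-- The number of vectors of `F ^ n` isotropic for the Hermitian form. -/
def numIsotropic (n : ℕ) : ℕ :=
  (Finset.univ.filter (fun x : Fin n → F => hermForm σ x x = 0)).card

theorem numIsotropic_succ (hq : 1 < q) (hF : Fintype.card F = q ^ 2) (hσ : ∀ x, σ x = x ^ q)
    (n : ℕ) : numIsotropic σ (n + 1) + q * numIsotropic σ n = (q + 1) * q ^ (2 * n) := by
  have h1 : numIsotropic σ (n + 1) =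
      ∑ x : Fin n → F, (Finset.univ.filter
        (fun a : F => a ^ (q + 1) = - hermForm σ x x)).card := by
    have e : numIsotropic σ (n + 1) = (Finset.univ.filter
        (fun p : (Fin n → F) × F => p.2 ^ (q + 1) = - hermForm σ p.1 p.1)).card := by
      symm
      refine Finset.card_bij (fun p _ => (Fin.cons p.2 p.1 : Fin (n + 1) → F)) ?_ ?_ ?_
      · rintro ⟨x, a⟩ h
        simp only [Finset.mem_filter, Finset.mem_univ, true_and] at h ⊢
        rw [hermForm_apply, Fin.sum_univ_succ]
        simp only [Fin.cons_zero, Fin.cons_succ]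
        rw [← hermForm_apply, hσ, ← pow_succ, h, neg_add_cancel]
      · rintro ⟨x, a⟩ _ ⟨y, b⟩ _ h
        obtain ⟨h1, h2⟩ := Fin.cons_injective2 h
        exact Prod.ext h2 h1
      · intro z hz
        simp only [Finset.mem_filter, Finset.mem_univ, true_and] at hz
        refine ⟨(Fin.tail z, z 0), ?_, Fin.cons_self_tail z⟩
        rw [hermForm_apply, Fin.sum_univ_succ, hσ, ← pow_succ] at hz
        simp only [Finset.mem_filter, Finset.mem_univ, true_and]
        exact eq_neg_of_add_eq_zero_left hz
    rw [e, Finset.card_filter, Fintype.sum_prod_type]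
    simp only [Finset.card_filter]
  have h2 : ∀ x : Fin n → F, (Finset.univ.filter
        (fun a : F => a ^ (q + 1) = - hermForm σ x x)).card +
        q * (if hermForm σ x x = 0 then 1 else 0) = q + 1 := by
    intro x
    split_ifs with h
    · have : (Finset.univ.filter (fun a : F => a ^ (q + 1) = - hermForm σ x x)) = {0} := by
        ext a
        simp [h]
      rw [this]
      simp [add_comm]
    · rw [card_norm_fiber hq hF (neg_ne_zero.2 h)]
      · simp
      · rw [← hσ, map_neg, map_hermForm (map_map_eq_self hF hσ)]
  rw [h1, numIsotropic, Finset.card_filter, Finset.mul_sum, ← Finset.sum_add_distrib,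
    Finset.sum_congr rfl fun x _ => h2 x]
  simp [hF, ← pow_mul, mul_comm]

theorem numIsotropic_five (hq : 1 < q) (hF : Fintype.card F = q ^ 2) (hσ : ∀ x, σ x = x ^ q) :
    numIsotropic σ 5 + q ^ 5 = q ^ 9 + q ^ 4 := by
  have h0 : numIsotropic σ 0 = 1 := by
    simp [numIsotropic, hermForm_apply]
  have h := numIsotropic_succ hq hF hσ
  have h1 := h 0
  have h2 := h 1
  have h3 := h 2
  have h4 := h 3
  have h5 := h 4
  rw [h0] at h1
  zify at *
  linear_combination h5 - q * h4 + q ^ 2 * h3 - q ^ 3 * h2 + q ^ 4 * h1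

/-- The number of vectors not orthogonal to a given nonzero vector. -/
theorem card_not_orthogonal (hF : Fintype.card F = q ^ 2) {n : ℕ} {x : Fin (n + 1) → F}
    (hx : x ≠ 0) :
    (Finset.univ.filter (fun y => hermForm σ x y ≠ 0)).card + q ^ (2 * n) =
      q ^ (2 * (n + 1)) := by
  classical
  have h1 := Module.Dual.finrank_ker_add_one_of_ne_zero (hermForm_ne_zero (σ := σ) hx)
  have h2 := Module.card_eq_pow_finrank (K := F) (V := LinearMap.ker (hermForm σ x))
  have h3 : Module.finrank F (LinearMap.ker (hermForm σ x)) = n := by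
    rw [Module.finrank_fin_fun] at h1
    omega
  rw [h3, hF, ← pow_mul, Fintype.card_subtype] at h2
  have h4 := Finset.card_filter_add_card_filter_not (s := (Finset.univ : Finset (Fin (n + 1) → F)))
    (fun y => hermForm σ x y = 0)
  simp only [LinearMap.mem_ker] at h2
  rw [h2] at h4
  have h5 : (Finset.univ : Finset (Fin (n + 1) → F)).card = q ^ (2 * (n + 1)) := by
    simp [hF, pow_mul]
  rw [h5] at h4
  rw [← h4, add_comm]

/-- Along each line in a nonorthogonal direction, one vector out of `q` is isotropic. -/
theorem card_isotropic_not_orthogonal (hq : 1 < q) (hF : Fintype.card F = q ^ 2)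
    (hσ : ∀ x, σ x = x ^ q) {n : ℕ} {x : Fin (n + 1) → F} (hx : x ≠ 0)
    (hxx : hermForm σ x x = 0) :
    q * (Finset.univ.filter (fun y => hermForm σ x y ≠ 0 ∧ hermForm σ y y = 0)).card +
      q ^ (2 * n) = q ^ (2 * (n + 1)) := by
  have hσσ := map_map_eq_self hF hσ
  rw [← card_not_orthogonal (σ := σ) hF hx]
  congr 1
  have hfib : ∀ y ∈ Finset.univ.filter (fun y => hermForm σ x y ≠ 0),
      (Finset.univ.filter (fun t : F => hermForm σ (y + t • x) (y + t • x) = 0)).card = q := by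
    intro y hy
    have hy : hermForm σ x y ≠ 0 := by simpa using hy
    have hyx : hermForm σ y x ≠ 0 := by
      rw [← map_hermForm hσσ]
      simpa using hy
    rw [← card_trace_fiber hq hF hσ (c := - hermForm σ y y)
      (by rw [← hσ, map_neg, map_hermForm hσσ])]
    refine Finset.card_bij (fun t _ => t * hermForm σ y x) ?_ ?_ ?_
    · intro t ht
      simp only [Finset.mem_filter, Finset.mem_univ, true_and] at ht ⊢
      rw [← hσ, map_mul, map_hermForm hσσ]
      simp only [map_add, map_smul, hermForm_add_left, hermForm_smul_left, hxx, smul_eq_mul] at ht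
      linear_combination ht
    · intro t _ u _ h
      exact mul_right_cancel₀ hyx h
    · intro u hu
      refine ⟨u / hermForm σ y x, ?_, by field_simp⟩
      simp only [Finset.mem_filter, Finset.mem_univ, true_and] at hu ⊢
      simp only [map_add, map_smul, hermForm_add_left, hermForm_smul_left, hxx, smul_eq_mul,
        map_div₀, map_hermForm hσσ]
      rw [← hσ] at hu
      have hxy : hermForm σ x y ≠ 0 := hy
      field_simp
      linear_combination (hermForm σ x y * hermForm σ y x) * hu
  have hswap := Finset.sum_card_bipartiteAbove_eq_sum_card_bipartiteBelow
    (s := Finset.univ.filter (fun y => hermForm σ x y ≠ 0)) (t := (Finset.univ : Finset F))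
    (fun y t => hermForm σ (y + t • x) (y + t • x) = 0)
  simp only [Finset.bipartiteAbove, Finset.bipartiteBelow] at hswap
  rw [Finset.sum_congr rfl hfib] at hswap
  have hfib2 : ∀ t ∈ (Finset.univ : Finset F),
      ((Finset.univ.filter (fun y => hermForm σ x y ≠ 0)).filter
        (fun y => hermForm σ (y + t • x) (y + t • x) = 0)).card =
      (Finset.univ.filter (fun y => hermForm σ x y ≠ 0 ∧ hermForm σ y y = 0)).card := by
    intro t _
    refine Finset.card_bij (fun y _ => y + t • x) ?_ ?_ ?_
    · intro y hy
      simp only [Finset.mem_filter, Finset.mem_univ, true_and] at hy ⊢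
      refine ⟨?_, hy.2⟩
      rw [map_add, map_smul, hxx, smul_zero, add_zero]
      exact hy.1
    · intro y _ z _ h
      exact add_right_cancel h
    · intro y hy
      refine ⟨y - t • x, ?_, sub_add_cancel _ _⟩
      simp only [Finset.mem_filter, Finset.mem_univ, true_and] at hy ⊢
      rw [sub_add_cancel, map_sub, map_smul, hxx, smul_zero, sub_zero]
      exact hy
  rw [Finset.sum_congr rfl hfib2, Finset.sum_const, Finset.sum_const, Finset.card_univ, hF,
    smul_eq_mul, smul_eq_mul] at hswap
  apply Nat.eq_of_mul_eq_mul_left (show 0 < q by omega)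
  linear_combination -hswap

/-- The number of isotropic vectors orthogonal to a given nonzero isotropic vector. -/
theorem card_isotropic_orthogonal (hq : 1 < q) (hF : Fintype.card F = q ^ 2)
    (hσ : ∀ x, σ x = x ^ q) {x : Fin 5 → F} (hx : x ≠ 0) (hxx : hermForm σ x x = 0) :
    (Finset.univ.filter (fun y => hermForm σ x y = 0 ∧ hermForm σ y y = 0)).card + q ^ 5 =
      q ^ 7 + q ^ 4 := by
  have h1 := card_isotropic_not_orthogonal hq hF hσ hx hxx
  have h2 := numIsotropic_five hq hF hσ
  have h3 := Finset.card_filter_add_card_filter_not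
    (s := Finset.univ.filter (fun y : Fin 5 → F => hermForm σ y y = 0))
    (fun y => hermForm σ x y = 0)
  rw [Finset.filter_filter, Finset.filter_filter, ← numIsotropic] at h3
  simp only [and_comm (b := hermForm σ x _ = 0), and_comm (b := ¬ hermForm σ x _ = 0)] at h3
  simp only [ne_eq] at h1
  apply Nat.eq_of_mul_eq_mul_left (show 0 < q by omega)
  zify at *
  linear_combination q * h3 + q * h2 - h1

end Counting

section LineRestriction

variable {F : Type} [Field F] {n d : ℕ} {G : MvPolynomial (Fin n) F}

theorem eval_smul_of_isHomogeneous_s5 (hGd : G.IsHomogeneous d) (a : F) (x : Fin n → F) :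
    eval (a • x) G = a ^ d * eval x G := by
  rw [eval_eq, eval_eq, Finset.mul_sum]
  refine Finset.sum_congr rfl fun m hm => ?_
  have hdeg : ∑ i ∈ m.support, m i = d := by
    rw [← hGd (mem_support_iff.1 hm), ← Finsupp.degree_apply]
    exact DFunLike.congr_fun Finsupp.degree_eq_weight_one m
  simp only [Pi.smul_apply, smul_eq_mul, mul_pow, Finset.prod_mul_distrib]
  rw [Finset.prod_pow_eq_pow_sum, hdeg]
  ring

/-- The restriction of a polynomial to the affine line through `y` with direction `x`. -/
def lineRestriction (G : MvPolynomial (Fin n) F) (x y : Fin n → F) : Polynomial F :=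
  aeval (fun i => Polynomial.C (x i) * Polynomial.X + Polynomial.C (y i)) G

theorem natDegree_lineRestriction_le (hGd : G.IsHomogeneous d) (x y : Fin n → F) :
    (lineRestriction G x y).natDegree ≤ d := by
  have := aeval_natDegree_le (n := 1) G hGd.totalDegree_le
    (fun i => Polynomial.C (x i) * Polynomial.X + Polynomial.C (y i))
    (fun i => Polynomial.natDegree_linear_le)
  rwa [mul_one] at this

theorem eval_lineRestriction (x y : Fin n → F) (u : F) :
    (lineRestriction G x y).eval u = eval (u • x + y) G := by
  rw [lineRestriction, ← Polynomial.coe_evalRingHom, aeval_def, hom_eval₂, eval, coe_eval₂Hom]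
  congr 1
  · ext a
    exact Polynomial.eval_C
  · ext i
    rw [Polynomial.coe_evalRingHom, Polynomial.eval_add, Polynomial.eval_mul,
      Polynomial.eval_C, Polynomial.eval_C, Polynomial.eval_X, mul_comm, Pi.add_apply,
      Pi.smul_apply, smul_eq_mul]

theorem lineRestriction_ne_zero [Fintype F] (hGd : G.IsHomogeneous d) {x : Fin n → F}
    (hx : eval x G ≠ 0) (hd : d + 1 < Fintype.card F) (y : Fin n → F) :
    lineRestriction G x y ≠ 0 := by
  classical
  intro h0
  have hzero : ∀ u : F, eval (u • x + y) G = 0 := by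
    intro u
    rw [← eval_lineRestriction, h0, Polynomial.eval_zero]
  have hne : lineRestriction G y x ≠ 0 := by
    intro h
    apply hx
    have := eval_lineRestriction (G := G) y x 0
    rw [h] at this
    simpa using this.symm
  have hle := (card_filter_eval_eq_zero_le hne).trans (natDegree_lineRestriction_le hGd y x)
  have hsub : (Finset.univ : Finset F).erase 0 ⊆
      Finset.univ.filter (fun v => (lineRestriction G y x).eval v = 0) := by
    intro v hv
    have hv : v ≠ 0 := by simpa using hv
    simp only [Finset.mem_filter, Finset.mem_univ, true_and, eval_lineRestriction]
    have : v • y + x = v • (v⁻¹ • x + y) := by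
      rw [smul_add, smul_smul, mul_inv_cancel₀ hv, one_smul, add_comm]
    rw [this, eval_smul_of_isHomogeneous_s5 hGd, hzero, mul_zero]
  have := Finset.card_le_card hsub
  rw [Finset.card_erase_of_mem (Finset.mem_univ _), Finset.card_univ] at this
  omega

end LineRestriction

section Pencils

variable {F V : Type} [Field F] [AddCommGroup V] [Module F V]

theorem finrank_span_pair {x y : V} (hx : x ≠ 0) (hy : y ∉ Submodule.span F {x}) :
    Module.finrank F (Submodule.span F {x, y}) = 2 := by
  have hli : LinearIndependent F ![x, y] := by
    rw [LinearIndependent.pair_iff' hx]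
    intro a ha
    exact hy (Submodule.mem_span_singleton.2 ⟨a, ha⟩)
  have := finrank_span_eq_card hli
  rwa [Matrix.range_cons_cons_empty, Fintype.card_fin] at this

theorem span_pair_eq [FiniteDimensional F V] {W : Submodule F V} (hW : Module.finrank F W = 2)
    {x y : V} (hx : x ≠ 0) (hxW : x ∈ W) (hyW : y ∈ W) (hy : y ∉ Submodule.span F {x}) :
    Submodule.span F {x, y} = W := by
  apply Submodule.eq_of_le_of_finrank_eq
  · rw [Submodule.span_le]
    rintro z (rfl | rfl)
    · exact hxW
    · exact hyW
  · rw [finrank_span_pair hx hy, hW]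

theorem exists_mem_notMem_span_singleton {W : Submodule F V}
    (hW : Module.finrank F W = 2) (x : V) : ∃ y ∈ W, y ∉ Submodule.span F {x} := by
  by_contra! h
  have h1 := Submodule.finrank_mono (R := F) (M := V) (s := W) (t := Submodule.span F {x}) h
  have h2 := finrank_span_le_card (R := F) ({x} : Set V)
  rw [Set.toFinset_singleton, Finset.card_singleton] at h2
  omega

end Pencils

theorem card_filter_mem_submodule {F : Type} [Field F] [Fintype F] {n : ℕ}
    (W : Submodule F (Fin n → F)) [DecidablePred (· ∈ W)] :
    (Finset.univ.filter (fun x => x ∈ W)).card = Fintype.card F ^ Module.finrank F W := by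
  rw [← Module.card_eq_pow_finrank (K := F) (V := W), Fintype.card_subtype]

open Classical in
/-- A form of degree `d` not vanishing on a line has at most `d` zeros on it, counted here as
nonzero vectors. -/
theorem card_zeros_on_line_le_s5 {F : Type} [Field F] [Fintype F] {n d : ℕ}
    {G : MvPolynomial (Fin n) F} (hGd : G.IsHomogeneous d) (hd0 : d ≠ 0)
    (hd : d + 1 < Fintype.card F) {W : Submodule F (Fin n → F)}
    (hW : Module.finrank F W = 2) {x : Fin n → F} (hxW : x ∈ W) (hx : eval x G ≠ 0) :
    (Finset.univ.filter (fun y => (y ≠ 0 ∧ eval y G = 0) ∧ y ∈ W)).card ≤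
      d * (Fintype.card F - 1) := by
  have hx0 : x ≠ 0 := by
    rintro rfl
    apply hx
    have := eval_smul_of_isHomogeneous_s5 hGd 0 (0 : Fin n → F)
    rwa [zero_pow hd0, zero_mul, smul_zero] at this
  obtain ⟨w, hwW, hw⟩ := exists_mem_notMem_span_singleton hW x
  have hspan := span_pair_eq hW hx0 hxW hwW hw
  have hroots := (card_filter_eval_eq_zero_le (lineRestriction_ne_zero hGd hx hd w)).trans
    (natDegree_lineRestriction_le hGd x w)
  have hsub : Finset.univ.filter (fun y => (y ≠ 0 ∧ eval y G = 0) ∧ y ∈ W) ⊆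
      Finset.image₂ (fun u t => t • (u • x + w))
        (Finset.univ.filter (fun u => (lineRestriction G x w).eval u = 0))
        ((Finset.univ : Finset F).erase 0) := by
    intro y hy
    simp only [Finset.mem_filter, Finset.mem_univ, true_and] at hy
    obtain ⟨⟨hy0, hyG⟩, hyW⟩ := hy
    rw [← hspan, Submodule.mem_span_pair] at hyW
    obtain ⟨s, t, rfl⟩ := hyW
    have ht : t ≠ 0 := by
      rintro rfl
      rw [zero_smul, add_zero, eval_smul_of_isHomogeneous_s5 hGd] at hyG
      rcases mul_eq_zero.1 hyG with h | h
      · apply hy0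
        rw [pow_eq_zero_iff hd0] at h
        simp [h]
      · exact hx h
    have e : t • ((s / t) • x + w) = s • x + t • w := by
      rw [smul_add, smul_smul, mul_div_cancel₀ _ ht]
    refine Finset.mem_image₂.2 ⟨s / t, ?_, t, by simpa using ht, e⟩
    simp only [Finset.mem_filter, Finset.mem_univ, true_and, eval_lineRestriction]
    rw [← e, eval_smul_of_isHomogeneous_s5 hGd] at hyG
    exact (mul_eq_zero.1 hyG).resolve_left (pow_ne_zero d ht)
  refine (Finset.card_le_card hsub).trans ((Finset.card_image₂_le _ _ _).trans ?_)
  rw [Finset.card_erase_of_mem (Finset.mem_univ _), Finset.card_univ]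
  exact Nat.mul_le_mul_right _ hroots

/-- A totally isotropic subspace of dimension two. -/
def IsGenerator {F : Type} [Field F] (σ : F →+* F) {n : ℕ} (W : Submodule F (Fin n → F)) : Prop :=
  Module.finrank F W = 2 ∧ ∀ x ∈ W, ∀ y ∈ W, hermForm σ x y = 0

section Generators

variable {F : Type} [Field F] {q : ℕ} {σ : F →+* F}

theorem isGenerator_span_pair (hσσ : ∀ a, σ (σ a) = a) {n : ℕ} {x y : Fin n → F} (hx : x ≠ 0)
    (hxx : hermForm σ x x = 0) (hxy : hermForm σ x y = 0) (hyy : hermForm σ y y = 0)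
    (hy : y ∉ Submodule.span F {x}) : IsGenerator σ (Submodule.span F {x, y}) := by
  refine ⟨finrank_span_pair hx hy, fun u hu v hv => ?_⟩
  have hyx : hermForm σ y x = 0 := by rw [← map_hermForm hσσ, hxy, map_zero]
  obtain ⟨a, b, rfl⟩ := Submodule.mem_span_pair.1 hu
  obtain ⟨c, e, rfl⟩ := Submodule.mem_span_pair.1 hv
  simp [hermForm_add_left, hermForm_smul_left, hxx, hxy, hyy, hyx]

variable [Fintype F]

open Classical in
/-- The number of generators through a given isotropic point is independent of the point. -/
theorem card_generators_through (hq : 1 < q) (hF : Fintype.card F = q ^ 2)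
    (hσ : ∀ x, σ x = x ^ q) [Fintype (Submodule F (Fin 5 → F))] {x : Fin 5 → F} (hx : x ≠ 0)
    (hxx : hermForm σ x x = 0) :
    (Finset.univ.filter (fun W => IsGenerator σ W ∧ x ∈ W)).card = q ^ 3 + 1 := by
  have hσσ := map_map_eq_self hF hσ
  have hM := card_isotropic_orthogonal hq hF hσ hx hxx
  have hspan : (Finset.univ.filter (fun y => y ∈ Submodule.span F {x})).card = q ^ 2 := by
    rw [card_filter_mem_submodule, finrank_span_singleton hx, hF, pow_one]
  have hsub : Finset.univ.filter (fun y => y ∈ Submodule.span F {x}) ⊆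
      Finset.univ.filter (fun y => hermForm σ x y = 0 ∧ hermForm σ y y = 0) := by
    intro y hy
    simp only [Finset.mem_filter, Finset.mem_univ, true_and] at hy ⊢
    obtain ⟨a, rfl⟩ := Submodule.mem_span_singleton.1 hy
    simp [hermForm_smul_left, hxx]
  have hR := Finset.card_sdiff_add_card_eq_card hsub
  have hmaps : ∀ y ∈ Finset.univ.filter (fun y => hermForm σ x y = 0 ∧ hermForm σ y y = 0) \
      Finset.univ.filter (fun y => y ∈ Submodule.span F {x}),
      Submodule.span F {x, y} ∈ Finset.univ.filter (fun W => IsGenerator σ W ∧ x ∈ W) := by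
    intro y hy
    simp only [Finset.mem_sdiff, Finset.mem_filter, Finset.mem_univ, true_and] at hy ⊢
    exact ⟨isGenerator_span_pair hσσ hx hxx hy.1.1 hy.1.2 hy.2,
      Submodule.subset_span (Set.mem_insert _ _)⟩
  have hfib : ∀ W ∈ Finset.univ.filter (fun W => IsGenerator σ W ∧ x ∈ W),
      ((Finset.univ.filter (fun y => hermForm σ x y = 0 ∧ hermForm σ y y = 0) \
        Finset.univ.filter (fun y => y ∈ Submodule.span F {x})).filter
          (fun y => Submodule.span F {x, y} = W)).card = q ^ 4 - q ^ 2 := by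
    intro W hW
    simp only [Finset.mem_filter, Finset.mem_univ, true_and] at hW
    obtain ⟨⟨hW2, hWi⟩, hxW⟩ := hW
    have hle : Submodule.span F {x} ≤ W := by
      rwa [Submodule.span_singleton_le_iff_mem]
    have hc : (Finset.univ.filter (fun y => y ∈ W)).card = q ^ 4 := by
      rw [card_filter_mem_submodule, hW2, hF, ← pow_mul]
    rw [← hc, ← hspan, ← Finset.card_sdiff_of_subset
      (Finset.monotone_filter_right _ fun y _ hy => hle hy)]
    congr 1
    ext y
    simp only [Finset.mem_sdiff, Finset.mem_filter, Finset.mem_univ, true_and]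
    constructor
    · rintro ⟨⟨_, h2⟩, rfl⟩
      exact ⟨Submodule.subset_span (Set.mem_insert_of_mem _ rfl), h2⟩
    · rintro ⟨h1, h2⟩
      exact ⟨⟨⟨hWi x hxW y h1, hWi y h1 y h1⟩, h2⟩, span_pair_eq hW2 hx hxW h1 h2⟩
  rw [Finset.card_eq_sum_card_fiberwise hmaps, Finset.sum_congr rfl hfib, Finset.sum_const,
    smul_eq_mul, hspan] at hR
  have hlt : q ^ 2 < q ^ 4 := Nat.pow_lt_pow_right hq (by norm_num)
  apply Nat.eq_of_mul_eq_mul_right (Nat.sub_pos_of_lt hlt)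
  zify [hlt.le] at *
  linear_combination hR + hM

open Classical in
/-- The number of generators of the Hermitian threefold. -/
theorem card_generators (hq : 1 < q) (hF : Fintype.card F = q ^ 2)
    (hσ : ∀ x, σ x = x ^ q) [Fintype (Submodule F (Fin 5 → F))] :
    (Finset.univ.filter (fun W : Submodule F (Fin 5 → F) => IsGenerator σ W)).card =
      (q ^ 3 + 1) * (q ^ 5 + 1) := by
  have hswap := Finset.sum_card_bipartiteAbove_eq_sum_card_bipartiteBelow
    (s := Finset.univ.filter (fun x : Fin 5 → F => hermForm σ x x = 0 ∧ x ≠ 0))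
    (t := Finset.univ.filter (fun W : Submodule F (Fin 5 → F) => IsGenerator σ W))
    (fun x W => x ∈ W)
  simp only [Finset.bipartiteAbove, Finset.bipartiteBelow, Finset.filter_filter] at hswap
  have hA : (Finset.univ.filter
      (fun x : Fin 5 → F => hermForm σ x x = 0 ∧ x ≠ 0)).card + 1 + q ^ 5 = q ^ 9 + q ^ 4 := by
    rw [← numIsotropic_five hq hF hσ, numIsotropic, ← Finset.filter_filter, Finset.filter_ne',
      Finset.card_erase_add_one (by simp)]
  have h1 : ∀ W ∈ Finset.univ.filter (fun W : Submodule F (Fin 5 → F) => IsGenerator σ W),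
      (Finset.univ.filter (fun x : Fin 5 → F => (hermForm σ x x = 0 ∧ x ≠ 0) ∧ x ∈ W)).card =
        q ^ 4 - 1 := by
    intro W hW
    obtain ⟨hW2, hWi⟩ : IsGenerator σ W := by simpa using hW
    have hc : (Finset.univ.filter (fun y => y ∈ W)).card = q ^ 4 := by
      rw [card_filter_mem_submodule, hW2, hF, ← pow_mul]
    rw [← hc, ← Finset.card_erase_of_mem (a := 0) (by simp)]
    congr 1
    ext y
    simp only [Finset.mem_erase, Finset.mem_filter, Finset.mem_univ, true_and]
    exact ⟨fun h => ⟨h.1.2, h.2⟩, fun h => ⟨⟨hWi y h.2 y h.2, h.1⟩, h.2⟩⟩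
  rw [Finset.sum_congr rfl h1, Finset.sum_congr rfl
    (fun x hx => card_generators_through hq hF hσ (Finset.mem_filter.1 hx).2.2
      (Finset.mem_filter.1 hx).2.1), Finset.sum_const, Finset.sum_const, smul_eq_mul,
    smul_eq_mul] at hswap
  have hlt : 1 < q ^ 4 := Nat.one_lt_pow (by norm_num) hq
  apply Nat.eq_of_mul_eq_mul_right (Nat.sub_pos_of_lt hlt)
  zify [hlt.le] at *
  linear_combination -hswap + (q ^ 3 + 1) * hA

open Classical in
/-- A form of degree `d` vanishing on no generator has at most `d * (q ^ 5 + 1)` zeros on the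
Hermitian threefold, counted here as nonzero vectors. -/
theorem card_isotropic_zeros_le (hq : 1 < q) (hF : Fintype.card F = q ^ 2)
    (hσ : ∀ x, σ x = x ^ q) {d : ℕ} {G : MvPolynomial (Fin 5) F} (hGd : G.IsHomogeneous d)
    (hd0 : d ≠ 0) (hd : d + 1 < q ^ 2)
    (hG : ∀ W : Submodule F (Fin 5 → F), IsGenerator σ W → ∃ x ∈ W, eval x G ≠ 0) :
    (Finset.univ.filter (fun x => hermForm σ x x = 0 ∧ x ≠ 0 ∧ eval x G = 0)).card ≤
      d * (q ^ 5 + 1) * (q ^ 2 - 1) := by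
  have : Fintype (Submodule F (Fin 5 → F)) := Fintype.ofFinite _
  have hswap := Finset.sum_card_bipartiteAbove_eq_sum_card_bipartiteBelow
    (s := Finset.univ.filter (fun x => hermForm σ x x = 0 ∧ x ≠ 0 ∧ eval x G = 0))
    (t := Finset.univ.filter (fun W : Submodule F (Fin 5 → F) => IsGenerator σ W))
    (fun x W => x ∈ W)
  simp only [Finset.bipartiteAbove, Finset.bipartiteBelow, Finset.filter_filter] at hswap
  have h1 : ∀ W ∈ Finset.univ.filter (fun W : Submodule F (Fin 5 → F) => IsGenerator σ W),
      (Finset.univ.filter (fun x => (hermForm σ x x = 0 ∧ x ≠ 0 ∧ eval x G = 0) ∧ x ∈ W)).card ≤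
        d * (q ^ 2 - 1) := by
    intro W hW
    have hW : IsGenerator σ W := by simpa using hW
    obtain ⟨x, hxW, hx⟩ := hG W hW
    rw [← hF] at hd ⊢
    refine le_trans (Finset.card_le_card ?_) (card_zeros_on_line_le_s5 hGd hd0 hd hW.1 hxW hx)
    exact Finset.monotone_filter_right _ fun y _ hy => ⟨hy.1.2, hy.2⟩
  have h2 := Finset.sum_le_sum h1
  rw [← hswap, Finset.sum_congr rfl
    (fun x hx => card_generators_through hq hF hσ (Finset.mem_filter.1 hx).2.2.1
      (Finset.mem_filter.1 hx).2.1), Finset.sum_const, Finset.sum_const, smul_eq_mul,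
    smul_eq_mul, card_generators hq hF hσ] at h2
  refine Nat.le_of_mul_le_mul_right (h2.trans (le_of_eq ?_)) (Nat.succ_pos (q ^ 3))
  ring

end Generators

/-- Over a field with `q ^ 2` elements, `x ↦ x ^ q` is a ring homomorphism. -/
theorem exists_ringHom_eq_pow {q : ℕ} (hq : IsPrimePow q) {F : Type} [Field F] [Fintype F]
    (hF : Fintype.card F = q ^ 2) : ∃ σ : F →+* F, ∀ x, σ x = x ^ q := by
  obtain ⟨p, k, hp, -, rfl⟩ := (isPrimePow_nat_iff q).1 hq
  have : Fact p.Prime := ⟨hp⟩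
  have : CharP F p := charP_of_card_eq_prime_pow (f := k * 2) (by rw [hF, pow_mul])
  exact ⟨iterateFrobenius F p k, fun x => iterateFrobenius_def p k x⟩

open Classical in
/-- Each point of a projective set accounts for `|F| - 1` nonzero vectors. -/
theorem ncard_mul_le_card {F V : Type} [Field F] [Fintype F] [AddCommGroup V] [Module F V]
    [Fintype V] (S : Set (Projectivization F V)) (T : Finset V)
    (h : ∀ P ∈ S, ∀ a : F, a ≠ 0 → a • P.rep ∈ T) : S.ncard * (Fintype.card F - 1) ≤ T.card := by
  have hfin := S.toFinite
  rw [Set.ncard_eq_toFinset_card S hfin, ← Finset.card_univ,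
    ← Finset.card_erase_of_mem (Finset.mem_univ (0 : F)), ← Finset.card_product]
  refine Finset.card_le_card_of_injOn (fun z => z.2 • z.1.rep) ?_ ?_
  · rintro ⟨P, a⟩ hz
    simp only [Finset.coe_product, Set.mem_prod, Finset.mem_coe, Set.Finite.mem_toFinset,
      Finset.mem_erase, Finset.mem_univ, and_true] at hz
    exact h P hz.1 a hz.2
  · rintro ⟨P, a⟩ hz ⟨Q, b⟩ hw hPQ
    simp only [Finset.coe_product, Set.mem_prod, Finset.mem_coe, Set.Finite.mem_toFinset,
      Finset.mem_erase, Finset.mem_univ, and_true] at hz hw hPQ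
    have hPQ' : P = Q := by
      rw [← P.mk_rep, ← Q.mk_rep, Projectivization.mk_eq_mk_iff']
      exact ⟨a⁻¹ * b, by rw [mul_smul, ← hPQ, inv_smul_smul₀ hz.2]⟩
    subst hPQ'
    rw [smul_left_injective F P.rep_nonzero hPQ]

theorem stmt5 (q : ℕ) (hq : IsPrimePow q)
    (F : Type) [Field F] [Fintype F] (hF : Fintype.card F = q ^ 2)
    (d : ℕ) (hd1 : 1 < d) (hdq : d ≤ q)
    (G : MvPolynomial (Fin 5) F) (hG : G ≠ 0) (hGd : G.IsHomogeneous d)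
    (hnogen : ∀ L : Set (P4 F), IsLine F L → L ⊆ hermV3 q F → ¬ L ⊆ VG G) :
    (VG G ∩ hermV3 q F).ncard ≤ d * (q ^ 5 + 1) ∧
      (VG G ∩ hermV3 q F).ncard < d * (q ^ 5 + q ^ 2) + q ^ 3 + 1 := by
  classical
  have hq1 : 1 < q := hq.one_lt
  obtain ⟨σ, hσ⟩ := exists_ringHom_eq_pow hq hF
  have hherm : ∀ P : P4 F, P ∈ hermV3 q F ↔ hermForm σ P.rep P.rep = 0 := by
    intro P
    simp only [hermV3, Set.mem_ofPred_eq, hermForm_apply, hσ, pow_succ]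
  have hgen : ∀ W : Submodule F (Fin 5 → F), IsGenerator σ W → ∃ x ∈ W, eval x G ≠ 0 := by
    intro W hW
    have hrep : ∀ P : P4 F, P.submodule ≤ W → P.rep ∈ W := fun P hP =>
      hP (by rw [P.submodule_eq]; exact Submodule.mem_span_singleton_self _)
    obtain ⟨P, hPW, hP⟩ := Set.not_subset.1 (hnogen {P | P.submodule ≤ W} ⟨W, hW.1, rfl⟩
      fun P hP => (hherm P).2 (hW.2 _ (hrep P hP) _ (hrep P hP)))
    exact ⟨P.rep, hrep P hPW, hP⟩
  have hbound := card_isotropic_zeros_le hq1 hF hσ hGd (by omega) (by nlinarith) hgen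
  have hpts := ncard_mul_le_card (VG G ∩ hermV3 q F)
    (Finset.univ.filter (fun x => hermForm σ x x = 0 ∧ x ≠ 0 ∧ eval x G = 0)) (by
      rintro P ⟨hPG, hPV⟩ a ha
      have hPG : eval P.rep G = 0 := hPG
      simp [hermForm_smul_left, (hherm P).1 hPV, ha, P.rep_nonzero,
        eval_smul_of_isHomogeneous_s5 hGd, hPG])
  rw [hF] at hpts
  have hmain : (VG G ∩ hermV3 q F).ncard ≤ d * (q ^ 5 + 1) :=
    Nat.le_of_mul_le_mul_right (hpts.trans hbound)
      (Nat.sub_pos_of_lt (Nat.one_lt_pow two_ne_zero hq1))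
  refine ⟨hmain, lt_of_le_of_lt hmain ?_⟩
  have h1 : d * 1 ≤ d * q ^ 2 := Nat.mul_le_mul_left d (Nat.one_le_pow _ _ (by omega))
  rw [mul_add, mul_add]
  omega
end
end
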